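/- Let n ≥ 1, let f : ℝⁿ × ℝⁿ × ℝ → ℂ be integrable, and suppose there is a measurable set B ⊆ ℝⁿ × ℝⁿ of finite Lebesgue measure such that f(x, y, t) = 0 for almost every (x, y, t) with (x, y) ∉ B. Suppose that for every real λ ≠ 0 there exist u_λ, v_λ ∈ L²(ℝⁿ, ℂ) such that for all φ, ψ ∈ L²(ℝⁿ, ℂ), ⟨φ, u_λ⟩ · ⟨v_λ, ψ⟩ = ∫_{ℝⁿ×ℝⁿ×ℝ} f(x, y, t) · exp(iλt) · A_λ(φ, ψ)(x, y) d(x, y, t) (that is, the group Fourier transform f̂(λ) is an operator of rank at most one for every λ ≠ 0). Then f = 0 almost everywhere. -/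

import Mathlib

open MeasureTheory Complex
open scoped RealInnerProductSpace

/-- The λ-Fourier–Wigner transform of two functions on ℝⁿ, as a function on ℝⁿ × ℝⁿ :
`A_λ(φ, ψ)(x, y) = ∫ exp (i λ (x·ζ + (1/2) x·y)) φ(ζ + y) conj (ψ ζ) dζ`. -/
noncomputable def fourierWigner (n : ℕ) (lam : ℝ)
    (φ ψ : EuclideanSpace ℝ (Fin n) → ℂ)
    (z : EuclideanSpace ℝ (Fin n) × EuclideanSpace ℝ (Fin n)) : ℂ :=
  ∫ ζ : EuclideanSpace ℝ (Fin n),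
    Complex.exp (Complex.I *
        Complex.ofReal (lam * (⟪z.1, ζ⟫ + (1 / 2 : ℝ) * ⟪z.1, z.2⟫))) *
      φ (ζ + z.2) * (starRingEnd ℂ) (ψ ζ)

/-- Euclidean space. -/
abbrev EE (n : ℕ) := EuclideanSpace ℝ (Fin n)
/-- The Hilbert space. -/
noncomputable abbrev LL (n : ℕ) := Lp ℂ 2 (volume : Measure (EuclideanSpace ℝ (Fin n)))


lemma norm_exp_I_ofReal (r : ℝ) : ‖Complex.exp (Complex.I * Complex.ofReal r)‖ = 1 := by
  rw [mul_comm]; exact Complex.norm_exp_ofReal_mul_I r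

lemma fw_repr (n : ℕ) (lam : ℝ) (ψ : LL n) (z : EE n × EE n) :
    ∃ w : LL n, ‖w‖ = ‖ψ‖ ∧ ∀ φ : LL n, fourierWigner n lam φ ψ z = inner ℂ w φ := by
  have hmp : MeasurePreserving (fun ξ : EE n => ξ - z.2) volume volume :=
    measurePreserving_sub_right volume z.2
  have h1 : MemLp (fun ξ : EE n => ψ (ξ - z.2)) 2 volume :=
    (Lp.memLp ψ).comp_measurePreserving hmp
  set g : EE n → ℂ := fun ξ => (starRingEnd ℂ) (Complex.exp (Complex.I *
        Complex.ofReal (lam * (⟪z.1, ξ - z.2⟫ + (1 / 2 : ℝ) * ⟪z.1, z.2⟫)))) * ψ (ξ - z.2) with hg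
  have hgn : ∀ ξ, ‖g ξ‖ = ‖ψ (ξ - z.2)‖ := by
    intro ξ
    simp only [hg, norm_mul, RCLike.norm_conj, norm_exp_I_ofReal, one_mul]
  have hgm : AEStronglyMeasurable g volume := by
    refine AEStronglyMeasurable.mul ?_ h1.1
    apply Continuous.aestronglyMeasurable
    fun_prop
  have h2 : MemLp g 2 volume := h1.congr_norm hgm (Filter.Eventually.of_forall fun ξ => (hgn ξ).symm)
  refine ⟨h2.toLp g, ?_, ?_⟩
  · rw [Lp.norm_toLp, Lp.norm_def]
    congr 1
    rw [← eLpNorm_comp_measurePreserving (Lp.aestronglyMeasurable ψ) hmp]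
    exact eLpNorm_congr_norm_ae (Filter.Eventually.of_forall hgn)
  · intro φ
    rw [L2.inner_def]
    have h3 : ∀ᵐ a : EE n, inner ℂ (h2.toLp g a) (φ a) = inner ℂ (g a) (φ a) := by
      filter_upwards [h2.coeFn_toLp] with a ha
      rw [ha]
    rw [integral_congr_ae h3]
    rw [fourierWigner, ← integral_sub_right_eq_self _ z.2]
    congr 1
    ext ξ
    simp only [hg, RCLike.inner_apply, map_mul, Complex.conj_conj, sub_add_cancel]
    ring

lemma fw_norm_le (n : ℕ) (lam : ℝ) (φ ψ : LL n) (z : EE n × EE n) :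
    ‖fourierWigner n lam φ ψ z‖ ≤ ‖φ‖ * ‖ψ‖ := by
  obtain ⟨w, hw, h⟩ := fw_repr n lam ψ z
  rw [h, ← hw, mul_comm]
  exact norm_inner_le_norm _ _

lemma fw_meas (n : ℕ) (lam : ℝ) (φ ψ : LL n) :
    StronglyMeasurable (fourierWigner n lam φ ψ) := by
  unfold fourierWigner
  apply StronglyMeasurable.integral_prod_right (f := fun (z : EE n × EE n) (ζ : EE n) =>
    Complex.exp (Complex.I *
        Complex.ofReal (lam * (⟪z.1, ζ⟫ + (1 / 2 : ℝ) * ⟪z.1, z.2⟫))) *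
      φ (ζ + z.2) * (starRingEnd ℂ) (ψ ζ))
  refine StronglyMeasurable.mul (StronglyMeasurable.mul ?_ ?_) ?_
  · apply Continuous.stronglyMeasurable
    fun_prop
  · exact (Lp.stronglyMeasurable φ).comp_measurable (g := fun p : (EE n × EE n) × EE n => p.2 + p.1.2) (by fun_prop)
  · exact Complex.continuous_conj.comp_stronglyMeasurable ((Lp.stronglyMeasurable ψ).comp_measurable measurable_snd)

lemma fw_integrable (n : ℕ) (lam : ℝ) (φ ψ : LL n) {G : EE n × EE n → ℂ} (hG : Integrable G) :
    Integrable (fun z => G z * fourierWigner n lam φ ψ z) := by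
  refine hG.mul_bdd (c := ‖φ‖ * ‖ψ‖) (fw_meas n lam φ ψ).aestronglyMeasurable ?_
  exact Filter.Eventually.of_forall fun z => fw_norm_le n lam φ ψ z

/-- `G` has Weyl transform `v ⊗ u`. -/
def IsW (n : ℕ) (lam : ℝ) (G : EE n × EE n → ℂ) (u v : LL n) : Prop :=
  ∀ φ ψ : LL n, ∫ z, G z * fourierWigner n lam φ ψ z = inner ℂ u φ * inner ℂ ψ v

lemma inner_eq_int (n : ℕ) (u φ : LL n) :
    inner ℂ u φ = ∫ ζ : EE n, φ ζ * (starRingEnd ℂ) (u ζ) := by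
  rw [L2.inner_def]; simp only [RCLike.inner_apply]


section generic
open scoped FourierTransform ContDiff SchwartzMap

variable {V : Type*} [NormedAddCommGroup V] [InnerProductSpace ℝ V] [FiniteDimensional ℝ V]
  [MeasurableSpace V] [BorelSpace V]

lemma fourier_flip {f g : V → ℂ} (hf : Integrable f) (hg : Integrable g) :
    ∫ ξ, 𝓕 f ξ * g ξ = ∫ x, f x * 𝓕 g x := by
  simpa using! VectorFourier.integral_bilin_fourierIntegral_eq_flip (.mul ℂ ℂ) (L := innerₗ V)
    Real.continuous_fourierChar continuous_inner hf hg

lemma fourier_inv_ae {k : V → ℂ} (hk : Integrable k) (hk' : Integrable (𝓕 k)) :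
    ∀ᵐ x, k x = 𝓕⁻ (𝓕 k) x := by
  have hc : Continuous (𝓕⁻ (𝓕 k)) := by
    have : 𝓕⁻ (𝓕 k) = fun w => 𝓕 (𝓕 k) (-w) := by
      ext w; exact Real.fourierInv_eq_fourier_neg _ _
    rw [this]
    have h2 : Continuous (𝓕 (𝓕 k)) :=
      VectorFourier.fourierIntegral_continuous Real.continuous_fourierChar
        (L := innerₗ V) continuous_inner hk'
    exact h2.comp continuous_neg
  refine ae_eq_of_integral_contDiff_smul_eq hk.locallyIntegrable hc.locallyIntegrable ?_
  intro g g_smooth g_cpt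
  have hg₁ : HasCompactSupport (Complex.ofRealCLM ∘ g) := g_cpt.comp_left rfl
  have hg₂ : ContDiff ℝ ∞ (Complex.ofRealCLM ∘ g) := by fun_prop
  set s : 𝓢(V, ℂ) := hg₁.toSchwartzMap hg₂ with hs
  have hsg : ∀ x, s x = (g x : ℂ) := fun x => rfl
  have e1 : 𝓕 (𝓕⁻ s) = s := FourierTransform.fourier_fourierInv_eq s
  have e2 : ∀ x, 𝓕 ((𝓕⁻ s : 𝓢(V, ℂ)) : V → ℂ) x = s x := by
    intro x
    rw [← SchwartzMap.fourier_coe, e1]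
  have e3 : ∀ x, (𝓕⁻ s : 𝓢(V, ℂ)) x = 𝓕 (s : V → ℂ) (-x) := by
    intro x
    rw [SchwartzMap.fourierInv_coe, Real.fourierInv_eq_fourier_neg]
  calc ∫ x, g x • k x = ∫ x, 𝓕 ((𝓕⁻ s : 𝓢(V, ℂ)) : V → ℂ) x * k x := by
        congr 1; ext x; rw [e2, hsg]; simp
    _ = ∫ x, (𝓕⁻ s : 𝓢(V, ℂ)) x * 𝓕 k x := fourier_flip (SchwartzMap.integrable _) hk
    _ = ∫ x, 𝓕 (s : V → ℂ) (-x) * 𝓕 k x := by simp only [e3]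
    _ = ∫ x, 𝓕 (s : V → ℂ) x * 𝓕 k (-x) := by
        rw [← integral_neg_eq_self]; simp
    _ = ∫ x, s x * 𝓕 (fun y => 𝓕 k (-y)) x := fourier_flip (SchwartzMap.integrable _) hk'.comp_neg
    _ = ∫ x, g x • 𝓕⁻ (𝓕 k) x := by
        congr 1; ext x
        rw [Real.fourierInv_eq_fourier_comp_neg, hsg]; simp

lemma fourier_sup {k : V → ℂ} (hk : Integrable k) (hk' : Integrable (𝓕 k)) :
    ∀ᵐ x, ‖k x‖ ≤ ∫ w, ‖𝓕 k w‖ := by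
  filter_upwards [fourier_inv_ae hk hk'] with x hx
  rw [hx]
  exact VectorFourier.norm_fourierIntegral_le_integral_norm _ _ _ _ _

lemma rect_ae {H : V × V → ℂ}
    (hI : ∀ m : ℕ, IntegrableOn H (Metric.ball 0 m ×ˢ Metric.ball 0 m))
    (h : ∀ (m : ℕ) (C D : Set V), MeasurableSet C → MeasurableSet D → C ⊆ Metric.ball 0 m →
      D ⊆ Metric.ball 0 m → ∫ p in C ×ˢ D, H p = 0) : ∀ᵐ p, H p = 0 := by
  have key : ∀ m : ℕ, ∀ᵐ p ∂(volume.restrict (Metric.ball (0:V) m ×ˢ Metric.ball (0:V) m)), H p = 0 := by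
    intro m
    have hb : MeasurableSet (Metric.ball (0:V) m ×ˢ Metric.ball (0:V) m) :=
      measurableSet_ball.prod measurableSet_ball
    have hrect : ∀ C D : Set V, MeasurableSet C → MeasurableSet D →
        ∫ p in C ×ˢ D, H p ∂(volume.restrict (Metric.ball (0:V) m ×ˢ Metric.ball (0:V) m)) = 0 := by
      intro C D hC hD
      rw [Measure.restrict_restrict (hC.prod hD), Set.prod_inter_prod]
      exact h m _ _ (hC.inter measurableSet_ball) (hD.inter measurableSet_ball)
        Set.inter_subset_right Set.inter_subset_right
    have htot : ∫ p, H p ∂(volume.restrict (Metric.ball (0:V) m ×ˢ Metric.ball (0:V) m)) = 0 := by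
      have := hrect Set.univ Set.univ .univ .univ
      rwa [Set.univ_prod_univ, setIntegral_univ] at this
    have hall : ∀ s : Set (V × V), MeasurableSet s →
        ∫ p in s, H p ∂(volume.restrict (Metric.ball (0:V) m ×ˢ Metric.ball (0:V) m)) = 0 := by
      intro s hs
      induction s, hs using MeasurableSpace.induction_on_inter generateFrom_prod.symm isPiSystem_prod with
      | empty => simp
      | basic t ht =>
        obtain ⟨C, hC, D, hD, rfl⟩ := ht
        exact hrect C D hC hD
      | compl t ht ih =>
        have := integral_add_compl ht (hI m)
        rw [ih, zero_add] at this
        rw [this, htot]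
      | iUnion f hd hm ih =>
        rw [integral_iUnion hm hd (hI m).integrableOn]
        simp [ih]
    exact Integrable.ae_eq_zero_of_forall_setIntegral_eq_zero (hI m) (fun s hs _ => hall s hs)
  have hU : (⋃ m : ℕ, Metric.ball (0:V) m ×ˢ Metric.ball (0:V) m) = Set.univ := by
    ext p
    simp only [Set.mem_iUnion, Set.mem_prod, mem_ball_zero_iff, Set.mem_univ, iff_true]
    obtain ⟨m, hm⟩ := exists_nat_gt (max ‖p.1‖ ‖p.2‖)
    exact ⟨m, (le_max_left _ _).trans_lt hm, (le_max_right _ _).trans_lt hm⟩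
  have := (ae_restrict_iUnion_iff (μ := volume) (fun m : ℕ => Metric.ball (0:V) m ×ˢ Metric.ball (0:V) m)
    (fun p => H p = 0)).2 key
  rwa [hU, Measure.restrict_univ] at this

end generic

lemma translate_meas {X : Type*} [NormedAddCommGroup X] [NormedSpace ℝ X] [FiniteDimensional ℝ X]
    [MeasurableSpace X] [BorelSpace X] (μ : Measure X) [μ.IsAddHaarMeasure]
    {B : Set X} (hB : MeasurableSet B) (hfin : μ B < ⊤) (N : ℕ) (a : X) :
    ∃ s : ℝ, 0 < s ∧ μ (⋃ j ∈ Finset.range N, (fun z => z + ((j : ℝ) * s) • a) ⁻¹' B) ≤ μ B + 2 := by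
  have hN : ((N : ENNReal) + 1)⁻¹ ≠ 0 := by
    simp
  obtain ⟨K, hKB, hK, hKm⟩ := hB.exists_isCompact_sdiff_lt hfin.ne hN
  have ht := tendsto_measure_cthickening_of_isCompact (μ := μ) hK
  have hKfin : μ K < ⊤ := hK.measure_lt_top
  have h1 : ∀ᶠ r in nhds (0:ℝ), μ (Metric.cthickening r K) < μ K + 1 :=
    ht.eventually_lt_const (ENNReal.lt_add_right hKfin.ne one_ne_zero)
  obtain ⟨r, hr0, hr⟩ := Metric.eventually_nhds_iff.1 h1
  have hr2 := hr (y := r / 2) (by rw [Real.dist_eq, sub_zero, abs_of_pos (by linarith)]; linarith)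
  refine ⟨r / 2 / (((N : ℝ) + 1) * (‖a‖ + 1)), by positivity, ?_⟩
  set s := r / 2 / (((N : ℝ) + 1) * (‖a‖ + 1)) with hs
  have hsub : (⋃ j ∈ Finset.range N, (fun z => z + ((j : ℝ) * s) • a) ⁻¹' B) ⊆
      Metric.cthickening (r / 2) K ∪
        ⋃ j ∈ Finset.range N, (fun z => z + ((j : ℝ) * s) • a) ⁻¹' (B \ K) := by
    intro z hz
    simp only [Set.mem_iUnion, Finset.mem_range, Set.mem_preimage, exists_prop] at hz
    obtain ⟨j, hj, hzj⟩ := hz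
    by_cases hzK : z + ((j : ℝ) * s) • a ∈ K
    · left
      refine Metric.mem_cthickening_of_dist_le z _ _ _ hzK ?_
      rw [dist_self_add_right, norm_smul, Real.norm_eq_abs]
      have hs0 : 0 < s := by positivity
      rw [abs_of_nonneg (by positivity)]
      have hj' : (j : ℝ) ≤ (N : ℝ) + 1 := by
        have : (j : ℝ) < N := by exact_mod_cast hj
        linarith
      calc (j : ℝ) * s * ‖a‖ ≤ ((N : ℝ) + 1) * s * (‖a‖ + 1) := by
            gcongr; linarith
        _ = r / 2 := by rw [hs]; field_simp
    · right
      simp only [Set.mem_iUnion, Finset.mem_range, Set.mem_preimage, exists_prop]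
      exact ⟨j, hj, hzj, hzK⟩
  calc μ _ ≤ μ _ := measure_mono hsub
    _ ≤ μ (Metric.cthickening (r / 2) K) +
        μ (⋃ j ∈ Finset.range N, (fun z => z + ((j : ℝ) * s) • a) ⁻¹' (B \ K)) := measure_union_le _ _
    _ ≤ (μ B + 1) + ∑ j ∈ Finset.range N, μ ((fun z => z + ((j : ℝ) * s) • a) ⁻¹' (B \ K)) := by
        gcongr
        · exact hr2.le.trans (by gcongr)
        · exact measure_biUnion_finset_le _ _
    _ ≤ (μ B + 1) + 1 := by
        gcongr
        simp only [measure_preimage_add_right, Finset.sum_const, Finset.card_range, nsmul_eq_mul]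
        calc (N : ENNReal) * μ (B \ K) ≤ ((N : ENNReal) + 1) * ((N : ENNReal) + 1)⁻¹ := by
              gcongr; exact le_self_add
          _ ≤ 1 := ENNReal.mul_inv_le_one _
    _ = μ B + 2 := by rw [add_assoc]; norm_num


/-- The phase. -/
noncomputable def ph {n : ℕ} (lam : ℝ) (x y ζ : EE n) : ℂ :=
  Complex.exp (Complex.I * Complex.ofReal (lam * (⟪x, ζ⟫ + (1 / 2 : ℝ) * ⟪x, y⟫)))

lemma norm_ph {n : ℕ} (lam : ℝ) (x y ζ : EE n) : ‖ph lam x y ζ‖ = 1 := norm_exp_I_ofReal _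

lemma cont_ph {n : ℕ} (lam : ℝ) : Continuous (fun p : EE n × (EE n × EE n) => ph lam p.2.1 p.2.2 p.1) := by
  unfold ph; fun_prop

/-- The kernel of the Weyl transform. -/
noncomputable def Kf {n : ℕ} (lam : ℝ) (G : EE n × EE n → ℂ) (p : EE n × EE n) : ℂ :=
  ∫ x, G (x, p.2 - p.1) * ph lam x (p.2 - p.1) p.1

lemma shear_mp (n : ℕ) : MeasurePreserving
    (fun q : (EE n × EE n) × EE n => (q.1.1, (q.2, q.1.2 - q.1.1))) volume volume := by
  have h1 : MeasurePreserving (fun p : EE n × (EE n × EE n) => (p.1, (p.2.2, p.2.1 - p.1)))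
      (volume.prod (volume.prod volume)) (volume.prod (volume.prod volume)) := by
    refine (MeasurePreserving.id volume).skew_product (g := fun ζ (q : EE n × EE n) => (q.2, q.1 - ζ))
      (by fun_prop) (Filter.Eventually.of_forall fun ζ => ?_)
    have h2 := (Measure.measurePreserving_swap (μ := (volume : Measure (EE n))) (ν := (volume : Measure (EE n)))).comp
      ((measurePreserving_sub_right (volume : Measure (EE n)) ζ).prod (MeasurePreserving.id (volume : Measure (EE n))))
    exact h2.map_eq
  exact h1.comp (measurePreserving_prodAssoc (volume : Measure (EE n)) (volume : Measure (EE n)) (volume : Measure (EE n)))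

lemma kernel_rect (n : ℕ) (lam : ℝ) {G : EE n × EE n → ℂ} (hGm : StronglyMeasurable G)
    (hG : Integrable G) {C D : Set (EE n)} (hC : MeasurableSet C) (hD : MeasurableSet D)
    (hC' : volume C ≠ ⊤) (hD' : volume D ≠ ⊤) :
    IntegrableOn (Kf lam G) (D ×ˢ C) ∧ ∫ p in D ×ˢ C, Kf lam G p =
      ∫ z, G z * fourierWigner n lam (indicatorConstLp 2 hC hC' (1:ℂ)) (indicatorConstLp 2 hD hD' (1:ℂ)) z := by
  set Q : EE n × (EE n × EE n) → ℂ := fun p => D.indicator (fun _ => (1:ℂ)) p.1 *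
    (C.indicator (fun _ => (1:ℂ)) (p.1 + p.2.2) * (G p.2 * ph lam p.2.1 p.2.2 p.1)) with hQ
  have hQm : StronglyMeasurable Q := by
    refine StronglyMeasurable.mul ?_ (StronglyMeasurable.mul ?_ (StronglyMeasurable.mul ?_ ?_))
    · exact (stronglyMeasurable_const.indicator hD).comp_measurable measurable_fst
    · exact (stronglyMeasurable_const.indicator hC).comp_measurable
        (g := fun p : EE n × (EE n × EE n) => p.1 + p.2.2) (by fun_prop)
    · exact hGm.comp_measurable measurable_snd
    · exact (cont_ph lam).stronglyMeasurable
  have hbase : Integrable (fun p : EE n × (EE n × EE n) => D.indicator (fun _ => (1:ℂ)) p.1 * G p.2)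
      (volume.prod volume) :=
    Integrable.mul_prod ((integrable_indicator_iff hD).2 (integrableOn_const hD')) hG
  have hQi : Integrable Q (volume.prod volume) := by
    refine hbase.mono hQm.aestronglyMeasurable (Filter.Eventually.of_forall fun p => ?_)
    simp only [hQ, norm_mul, norm_ph, mul_one]
    gcongr
    have : ‖C.indicator (fun _ => (1:ℂ)) (p.1 + p.2.2)‖ ≤ 1 := by
      by_cases h : p.1 + p.2.2 ∈ C <;> simp [h]
    nlinarith [norm_nonneg (G p.2)]
  have hmp := shear_mp n
  have hcomp : ∀ q : (EE n × EE n) × EE n, Q (q.1.1, (q.2, q.1.2 - q.1.1)) =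
      (D ×ˢ C).indicator (fun _ => (1:ℂ)) q.1 * (G (q.2, q.1.2 - q.1.1) * ph lam q.2 (q.1.2 - q.1.1) q.1.1) := by
    intro q
    simp only [hQ, add_sub_cancel]
    by_cases h1 : q.1.1 ∈ D <;> by_cases h2 : q.1.2 ∈ C <;> simp [h1, h2, Set.indicator]
  have hQc : Integrable (fun q : (EE n × EE n) × EE n => (D ×ˢ C).indicator (fun _ => (1:ℂ)) q.1 *
      (G (q.2, q.1.2 - q.1.1) * ph lam q.2 (q.1.2 - q.1.1) q.1.1)) (volume.prod volume) := by
    have := (hmp.integrable_comp (g := Q) hQm.aestronglyMeasurable).2 hQi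
    refine this.congr (Filter.Eventually.of_forall fun q => hcomp q)
  have hin : ∀ p : EE n × EE n, ∫ x, (D ×ˢ C).indicator (fun _ => (1:ℂ)) p *
      (G (x, p.2 - p.1) * ph lam x (p.2 - p.1) p.1) = (D ×ˢ C).indicator (Kf lam G) p := by
    intro p
    rw [integral_const_mul]
    by_cases h : p ∈ D ×ˢ C
    · rw [Set.indicator_of_mem h, Set.indicator_of_mem h, one_mul]; rfl
    · rw [Set.indicator_of_notMem h, Set.indicator_of_notMem h, zero_mul]
  have hI := hQc.integral_prod_left
  simp only [hin] at hI
  refine ⟨(integrable_indicator_iff (hD.prod hC)).1 hI, ?_⟩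
  rw [← integral_indicator (hD.prod hC)]
  calc ∫ p, (D ×ˢ C).indicator (Kf lam G) p
      = ∫ q : (EE n × EE n) × EE n, (D ×ˢ C).indicator (fun _ => (1:ℂ)) q.1 *
      (G (q.2, q.1.2 - q.1.1) * ph lam q.2 (q.1.2 - q.1.1) q.1.1) ∂(volume.prod volume) := by
        rw [integral_prod _ hQc]; simp only [hin]
    _ = ∫ q : (EE n × EE n) × EE n, Q (q.1.1, (q.2, q.1.2 - q.1.1)) := by
        simp only [hcomp]; rfl
    _ = ∫ p, Q p := by
        conv_rhs => rw [← hmp.map_eq]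
        rw [integral_map hmp.measurable.aemeasurable hQm.aestronglyMeasurable]
    _ = ∫ z, ∫ ζ, Q (ζ, z) := integral_prod_symm Q hQi
    _ = _ := by
        congr 1; ext z
        rw [fourierWigner, ← integral_const_mul]
        apply integral_congr_ae
        have a1 := indicatorConstLp_coeFn (p := 2) (hs := hD) (hμs := hD') (c := (1:ℂ))
        have a2 := indicatorConstLp_coeFn (p := 2) (hs := hC) (hμs := hC') (c := (1:ℂ))
        have a3 := (measurePreserving_add_right (volume : Measure (EE n)) z.2).quasiMeasurePreserving.ae a2
        filter_upwards [a1, a3] with ζ h1 h3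
        rw [h1, h3]
        simp only [hQ, ph]
        have : (starRingEnd ℂ) (D.indicator (fun _ => (1:ℂ)) ζ) = D.indicator (fun _ => (1:ℂ)) ζ := by
          by_cases h : ζ ∈ D <;> simp [h]
        rw [this]
        ring

lemma kernel_eq (n : ℕ) (lam : ℝ) {G : EE n × EE n → ℂ} (hGm : StronglyMeasurable G)
    (hG : Integrable G) {u v : LL n} (hW : IsW n lam G u v) :
    ∀ᵐ p : EE n × EE n, Kf lam G p = v p.1 * (starRingEnd ℂ) (u p.2) := by
  have hvu : ∀ {C D : Set (EE n)}, volume C ≠ ⊤ → volume D ≠ ⊤ →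
      IntegrableOn (fun p : EE n × EE n => v p.1 * (starRingEnd ℂ) (u p.2)) (D ×ˢ C) := by
    intro C D hC hD
    have h1 : IntegrableOn v D volume := integrableOn_Lp_of_measure_ne_top v (by norm_num) hD
    have h2 : IntegrableOn u C volume := integrableOn_Lp_of_measure_ne_top u (by norm_num) hC
    have h3 : IntegrableOn (fun x => (starRingEnd ℂ) (u x)) C volume := 
      (Complex.conjLIE.toContinuousLinearEquiv : ℂ →L[ℝ] ℂ).integrable_comp h2
    have := Integrable.mul_prod h1 h3
    rwa [Measure.prod_restrict] at this
  have hball : ∀ m : ℕ, volume (Metric.ball (0 : EE n) m) ≠ ⊤ := fun m => measure_ball_lt_top.ne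
  have := rect_ae (H := fun p => Kf lam G p - v p.1 * (starRingEnd ℂ) (u p.2)) ?_ ?_
  · filter_upwards [this] with p hp
    exact sub_eq_zero.1 hp
  · intro m
    exact (kernel_rect n lam hGm hG measurableSet_ball measurableSet_ball (hball m) (hball m)).1.sub
      (hvu (hball m) (hball m))
  · intro m D C hD hC hDm hCm
    have hD' : volume D ≠ ⊤ := ((measure_mono hDm).trans_lt (hball m).lt_top).ne
    have hC' : volume C ≠ ⊤ := ((measure_mono hCm).trans_lt (hball m).lt_top).ne
    obtain ⟨h1, h2⟩ := kernel_rect n lam hGm hG hC hD hC' hD'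
    rw [integral_sub h1 (hvu hC' hD'), h2, hW, L2.inner_indicatorConstLp_one]
    have h3 : inner ℂ u (indicatorConstLp 2 hC hC' (1:ℂ)) = ∫ x in C, (starRingEnd ℂ) (u x) := by
      rw [← inner_conj_symm, L2.inner_indicatorConstLp_one, ← integral_conj]
    have h4 := setIntegral_prod_mul (μ := (volume : Measure (EE n))) (ν := (volume : Measure (EE n)))
      v (fun x => (starRingEnd ℂ) (u x)) D C
    rw [h3, sub_eq_zero, mul_comm]
    exact h4.symm

lemma holder_trans (n : ℕ) (u v : LL n) (y : EE n) :
    Integrable (fun ζ => v ζ * (starRingEnd ℂ) (u (ζ + y))) ∧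
      ∫ ζ, ‖v ζ * (starRingEnd ℂ) (u (ζ + y))‖ ≤ ‖u‖ * ‖v‖ := by
  have hmp : MeasurePreserving (fun ξ : EE n => ξ + y) volume volume :=
    measurePreserving_add_right volume y
  have h1 : MemLp (fun ξ : EE n => u (ξ + y)) 2 volume :=
    (Lp.memLp u).comp_measurePreserving hmp
  have h2 : MemLp (fun ξ : EE n => (starRingEnd ℂ) (u (ξ + y))) 2 volume := h1.star
  refine ⟨(Lp.memLp v).integrable_mul h2, ?_⟩
  have h3 := eLpNorm_smul_le_mul_eLpNorm (p := 2) (q := 2) (r := 1) h2.1 (Lp.memLp v).1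
  have h4 : eLpNorm (fun ξ : EE n => (starRingEnd ℂ) (u (ξ + y))) 2 volume = eLpNorm u 2 volume := by
    rw [← eLpNorm_comp_measurePreserving (Lp.aestronglyMeasurable u) hmp]
    exact eLpNorm_congr_norm_ae (Filter.Eventually.of_forall fun x => by simp)
  rw [h4] at h3
  have h5 := ENNReal.toReal_mono (ENNReal.mul_ne_top (Lp.eLpNorm_ne_top v) (Lp.eLpNorm_ne_top u)) h3
  rw [ENNReal.toReal_mul, eLpNorm_one_eq_lintegral_enorm] at h5
  have h6 := integral_norm_eq_lintegral_enorm ((Lp.memLp v).integrable_mul h2).1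
  rw [Lp.norm_def, Lp.norm_def, mul_comm]
  exact h6.le.trans h5


open scoped FourierTransform in
lemma sup_bound0 (n : ℕ) (lam : ℝ) (hl : lam ≠ 0) {G : EE n × EE n → ℂ} (hGm : StronglyMeasurable G)
    (hG : Integrable G) {u v : LL n} (hW : IsW n lam G u v) :
    ∀ᵐ z, ‖G z‖ ≤ |(-lam / (2 * Real.pi)) ^ n| * (‖u‖ * ‖v‖) := by
  set c0 : ℝ := -lam / (2 * Real.pi) with hc0
  have hc : c0 ≠ 0 := div_ne_zero (neg_ne_zero.2 hl) (by positivity)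
  have hk := kernel_eq n lam hGm hG hW
  have hk1 := (measurePreserving_prod_add (volume : Measure (EE n)) volume).quasiMeasurePreserving.ae hk
  have hk2 := (Measure.measurePreserving_swap (μ := (volume : Measure (EE n)))
    (ν := (volume : Measure (EE n)))).quasiMeasurePreserving.ae hk1
  have hk3 := Measure.ae_ae_of_ae_prod hk2
  have hGl : ∀ᵐ y : EE n, Integrable (fun x => G (x, y)) volume := Integrable.prod_left_ae hG
  have key : ∀ᵐ y : EE n, ∀ᵐ x : EE n, ‖G (x, y)‖ ≤ |c0 ^ n| * (‖u‖ * ‖v‖) := by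
    filter_upwards [hk3, hGl] with y hy hGy
    set k : EE n → ℂ := fun x => G (x, y) *
      Complex.exp (Complex.I * Complex.ofReal (lam * ((1 / 2 : ℝ) * ⟪x, y⟫))) with hkdef
    have hkn : ∀ x, ‖k x‖ = ‖G (x, y)‖ := fun x => by
      simp only [hkdef, norm_mul, norm_exp_I_ofReal, mul_one]
    have hki : Integrable k := by
      refine hGy.mono (hGy.1.mul ?_) (Filter.Eventually.of_forall fun x => (hkn x).le)
      apply Continuous.aestronglyMeasurable
      fun_prop
    have hF : ∀ ζ, 𝓕 k (c0 • ζ) = Kf lam G (ζ, ζ + y) := by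
      intro ζ
      rw [Real.fourier_eq', Kf]
      congr 1; ext x
      simp only [add_sub_cancel_left, ph, hkdef, smul_eq_mul, inner_smul_right]
      rw [mul_left_comm, ← Complex.exp_add]
      congr 2
      rw [hc0]
      have : (Real.pi : ℂ) ≠ 0 := by exact_mod_cast Real.pi_ne_zero
      push_cast
      field_simp
    have hFae : (fun ζ => 𝓕 k (c0 • ζ)) =ᵐ[volume] fun ζ => v ζ * (starRingEnd ℂ) (u (ζ + y)) := by
      filter_upwards [hy] with ζ hζ
      rw [hF]; exact hζ
    obtain ⟨i1, i2⟩ := holder_trans n u v y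
    have hFi : Integrable (𝓕 k) := (integrable_comp_smul_iff volume _ hc).1 (i1.congr hFae.symm)
    have hint : ∫ w, ‖𝓕 k w‖ ≤ |c0 ^ n| * (‖u‖ * ‖v‖) := by
      have h1 := Measure.integral_comp_smul (volume : Measure (EE n)) (fun w => ‖𝓕 k w‖) c0
      have h2 : ∫ ζ, ‖𝓕 k (c0 • ζ)‖ = ∫ ζ, ‖v ζ * (starRingEnd ℂ) (u (ζ + y))‖ :=
        integral_congr_ae (by filter_upwards [hFae] with ζ hζ; rw [hζ])
      rw [h2, finrank_euclideanSpace_fin, smul_eq_mul, abs_inv] at h1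
      have hpos : 0 < |c0 ^ n| := abs_pos.2 (pow_ne_zero _ hc)
      have h3 : ∫ w, ‖𝓕 k w‖ = |c0 ^ n| * ∫ ζ, ‖v ζ * (starRingEnd ℂ) (u (ζ + y))‖ := by
        rw [h1]; field_simp
      rw [h3]; gcongr
    filter_upwards [fourier_sup hki hFi] with x hx
    rw [← hkn]; exact hx.trans hint
  have hms : MeasurableSet {p : EE n × EE n | ‖G p.swap‖ ≤ |c0 ^ n| * (‖u‖ * ‖v‖)} :=
    measurableSet_le ((hGm.measurable.comp measurable_swap).norm) measurable_const
  have h1 := (Measure.ae_prod_iff_ae_ae (μ := (volume : Measure (EE n))) (ν := (volume : Measure (EE n))) hms).2 key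
  have h2 := (Measure.measurePreserving_swap (μ := (volume : Measure (EE n)))
    (ν := (volume : Measure (EE n)))).quasiMeasurePreserving.ae h1
  filter_upwards [h2] with z hz
  exact hz

lemma IsW.congr {n : ℕ} {lam : ℝ} {G G' : EE n × EE n → ℂ} {u v : LL n} (hW : IsW n lam G u v)
    (h : G =ᵐ[volume] G') : IsW n lam G' u v := by
  intro φ ψ
  rw [← hW φ ψ]
  apply integral_congr_ae
  filter_upwards [h] with z hz
  rw [hz]

lemma sup_bound (n : ℕ) (lam : ℝ) (hl : lam ≠ 0) {G : EE n × EE n → ℂ}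
    (hG : Integrable G) {u v : LL n} (hW : IsW n lam G u v) :
    ∀ᵐ z, ‖G z‖ ≤ |(-lam / (2 * Real.pi)) ^ n| * (‖u‖ * ‖v‖) := by
  have h := hG.1.ae_eq_mk
  filter_upwards [h, sup_bound0 n lam hl hG.1.stronglyMeasurable_mk (hG.congr h) (hW.congr h)] with z h1 h2
  rw [h1]; exact h2

lemma exists_mod (n : ℕ) (lam : ℝ) (b : EE n) (u : LL n) :
    ∃ w : LL n, ∀ᵐ ξ, w ξ = Complex.exp (Complex.I * Complex.ofReal (lam * ⟪b, ξ⟫)) * u ξ := by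
  have h : MemLp (fun ξ => Complex.exp (Complex.I * Complex.ofReal (lam * ⟪b, ξ⟫)) * u ξ) 2 volume := by
    refine (Lp.memLp u).congr_norm ?_ (Filter.Eventually.of_forall fun ξ => ?_)
    · refine AEStronglyMeasurable.mul ?_ (Lp.aestronglyMeasurable u)
      apply Continuous.aestronglyMeasurable
      fun_prop
    · rw [norm_mul, norm_exp_I_ofReal, one_mul]
  exact ⟨h.toLp _, h.coeFn_toLp⟩

instance volProdHaar (n : ℕ) : (volume : Measure (EE n × EE n)).IsAddHaarMeasure :=
  inferInstanceAs (((volume : Measure (EE n)).prod (volume : Measure (EE n))).IsAddHaarMeasure)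

lemma shift_lemma (n : ℕ) (lam : ℝ) {G : EE n × EE n → ℂ} (hG : Integrable G) {u v : LL n}
    (hW : IsW n lam G u v) {B : Set (EE n × EE n)} (hB : ∀ᵐ z, z ∉ B → G z = 0) (b : EE n)
    {w : LL n} (hw : ∀ᵐ ξ, w ξ = Complex.exp (Complex.I * Complex.ofReal (lam * ⟪b, ξ⟫)) * u ξ) :
    ∃ G' : EE n × EE n → ℂ, Integrable G' ∧ IsW n lam G' w v ∧
      ∀ᵐ z, z + (b, 0) ∉ B → G' z = 0 := by
  have hmp : MeasurePreserving (fun z : EE n × EE n => z + (b, (0 : EE n))) volume volume :=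
    measurePreserving_add_right volume _
  have hGb : Integrable (fun z => G (z + (b, 0))) := hmp.integrable_comp_of_integrable hG
  set P : EE n × EE n → ℂ := fun z =>
    Complex.exp (Complex.I * Complex.ofReal (-(lam * (1 / 2 : ℝ) * ⟪b, z.2⟫))) with hP
  have hPc : Continuous P := by simp only [hP]; fun_prop
  have hPn : ∀ z, ‖P z‖ = 1 := fun z => norm_exp_I_ofReal _
  refine ⟨fun z => P z * G (z + (b, 0)), ?_, ?_, ?_⟩
  · exact hGb.bdd_mul hPc.aestronglyMeasurable (c := 1)
      (Filter.Eventually.of_forall fun z => (hPn z).le)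
  · intro φ ψ
    obtain ⟨φ', hφ'⟩ := exists_mod n lam (-b) φ
    have hA : ∀ z, P z * fourierWigner n lam φ ψ (z - (b, 0)) = fourierWigner n lam φ' ψ z := by
      intro z
      rw [fourierWigner, fourierWigner, ← integral_const_mul]
      apply integral_congr_ae
      have a3 := (measurePreserving_add_right (volume : Measure (EE n)) z.2).quasiMeasurePreserving.ae hφ'
      filter_upwards [a3] with ζ h3
      rw [h3]
      simp only [hP, Prod.fst_sub, Prod.snd_sub, sub_zero, ← mul_assoc, ← Complex.exp_add]
      congr 3
      simp only [inner_sub_left, inner_add_right, inner_neg_left]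
      push_cast
      ring
    have hPb : ∀ z : EE n × EE n, P (z - (b, 0)) = P z := fun z => by simp [hP]
    rw [← integral_sub_right_eq_self _ ((b, 0) : EE n × EE n)]
    have : ∀ z : EE n × EE n, P (z - (b, 0)) * G (z - (b, 0) + (b, 0)) * fourierWigner n lam φ ψ (z - (b, 0))
        = G z * fourierWigner n lam φ' ψ z := by
      intro z
      rw [← hA, hPb, sub_add_cancel]; ring
    simp only [this]
    rw [hW]
    congr 1
    rw [inner_eq_int, inner_eq_int]
    apply integral_congr_ae
    filter_upwards [hφ', hw] with ξ h1 h2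
    rw [h1, h2, map_mul, ← Complex.exp_conj]
    simp only [map_mul, Complex.conj_I, Complex.conj_ofReal, inner_neg_left]
    rw [mul_assoc, mul_left_comm (φ ξ), ← mul_assoc]
    rw [mul_assoc]
    congr 2
    push_cast; ring
  · filter_upwards [hmp.quasiMeasurePreserving.ae hB] with z hz h
    rw [hz h, mul_zero]

lemma level_null (n : ℕ) (a : EE n) (ha : a ≠ 0) (c : ℝ) : volume {ξ : EE n | ⟪a, ξ⟫ = c} = 0 := by
  rcases Set.eq_empty_or_nonempty {ξ : EE n | ⟪a, ξ⟫ = c} with h | ⟨ξ0, h0⟩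
  · rw [h]; simp
  · have : {ξ : EE n | ⟪a, ξ⟫ = c} = (fun ξ => ξ + (-ξ0)) ⁻¹' ((innerSL ℝ a).ker : Set (EE n)) := by
      ext ξ
      have h0' : ⟪a, ξ0⟫ = c := h0
      simp only [Set.mem_setOf_eq, Set.mem_preimage, SetLike.mem_coe, LinearMap.mem_ker,
        ContinuousLinearMap.coe_coe, innerSL_apply_apply, inner_add_right, inner_neg_right, h0']
      constructor <;> intro h <;> linarith
    rw [this, measure_preimage_add_right]
    apply Measure.addHaar_submodule
    intro htop
    have : a ∈ (innerSL ℝ a).ker := by rw [htop]; trivial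
    simp at this
    exact ha this

lemma exp_level_null (n : ℕ) (a : EE n) (ha : a ≠ 0) (r : ℝ) (hr : r ≠ 0) (ω : ℂ) :
    volume {ξ : EE n | Complex.exp (Complex.I * Complex.ofReal (r * ⟪a, ξ⟫)) = ω} = 0 := by
  rcases Set.eq_empty_or_nonempty {ξ : EE n | Complex.exp (Complex.I * Complex.ofReal (r * ⟪a, ξ⟫)) = ω} with h | ⟨ξ0, h0⟩
  · rw [h]; simp
  · refine measure_mono_null (t := ⋃ k : ℤ, {ξ : EE n | ⟪a, ξ⟫ = ⟪a, ξ0⟫ + k * (2 * Real.pi) / r}) ?_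
      (measure_iUnion_null fun k => level_null n a ha _)
    intro ξ hξ
    have h0' : Complex.exp (Complex.I * Complex.ofReal (r * ⟪a, ξ0⟫)) = ω := h0
    have hξ' : Complex.exp (Complex.I * Complex.ofReal (r * ⟪a, ξ⟫)) = ω := hξ
    rw [← h0', Complex.exp_eq_exp_iff_exists_int] at hξ'
    obtain ⟨k, hk⟩ := hξ'
    rw [Set.mem_iUnion]
    refine ⟨k, ?_⟩
    have h1 : Complex.I * ((r * ⟪a, ξ⟫ : ℝ) : ℂ) = Complex.I * ((r * ⟪a, ξ0⟫ + k * (2 * Real.pi) : ℝ) : ℂ) := by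
      rw [hk]; push_cast; ring
    have h2 := Complex.ofReal_injective (mul_left_cancel₀ Complex.I_ne_zero h1)
    show ⟪a, ξ⟫ = ⟪a, ξ0⟫ + k * (2 * Real.pi) / r
    field_simp
    linarith

lemma lin_indep (n : ℕ) (lam : ℝ) (hl : lam ≠ 0) (a : EE n) (ha : a ≠ 0) (s : ℝ) (hs : 0 < s)
    (u : LL n) (hu : u ≠ 0) (N : ℕ) (w : Fin N → LL n)
    (hw : ∀ j : Fin N, ∀ᵐ ξ, w j ξ =
      Complex.exp (Complex.I * Complex.ofReal (lam * ⟪(((j : ℕ) : ℝ) * s) • a, ξ⟫)) * u ξ) :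
    LinearIndependent ℂ w := by
  rw [Fintype.linearIndependent_iff]
  intro g hg
  by_contra! hne
  obtain ⟨i, hi⟩ := hne
  set p : Polynomial ℂ := ∑ j : Fin N, Polynomial.monomial (j : ℕ) (g j) with hp
  have hp0 : p ≠ 0 := by
    intro h
    apply hi
    have : p.coeff i = g i := by
      rw [hp, Polynomial.finsetSum_coeff]
      simp [Polynomial.coeff_monomial, Fin.val_inj]
    rw [← this, h, Polynomial.coeff_zero]
  apply hu
  rw [Lp.eq_zero_iff_ae_eq_zero]
  have hsum : ∀ᵐ ξ, ∑ j, g j * w j ξ = 0 := by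
    have h1 : ((∑ j, g j • w j : LL n) : EE n → ℂ) =ᵐ[volume] 0 := by rw [hg]; exact Lp.coeFn_zero _ _ _
    have h2 := Lp.coeFn_finsetSum (E := ℂ) (p := 2) (μ := (volume : Measure (EE n))) Finset.univ (fun j => g j • w j)
    have h3 : ∀ᵐ ξ, ∀ j, (g j • w j : LL n) ξ = g j * w j ξ := by
      rw [ae_all_iff]; intro j
      exact Lp.coeFn_smul (g j) (w j)
    filter_upwards [h1, h2, h3] with ξ a1 a2 a3
    rw [a1] at a2
    simp only [Finset.sum_apply, a3] at a2
    exact a2.symm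
  have hroots : ∀ᵐ ξ : EE n, ∀ ω ∈ p.roots.toFinset,
      Complex.exp (Complex.I * Complex.ofReal ((lam * s) * ⟪a, ξ⟫)) ≠ ω := by
    refine (ae_ball_iff (Finset.countable_toSet p.roots.toFinset)).2 ?_
    intro ω _
    rw [ae_iff]
    simp only [ne_eq, not_not]
    exact exp_level_null n a ha (lam * s) (mul_ne_zero hl hs.ne') ω
  filter_upwards [hsum, hroots, ae_all_iff.2 hw] with ξ h1 h2 h3
  simp only [h3] at h1
  set X := Complex.exp (Complex.I * Complex.ofReal ((lam * s) * ⟪a, ξ⟫)) with hX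
  have h4 : ∀ j : Fin N, Complex.exp (Complex.I * Complex.ofReal (lam * ⟪(((j : ℕ) : ℝ) * s) • a, ξ⟫)) = X ^ (j : ℕ) := by
    intro j
    rw [hX, ← Complex.exp_nat_mul, real_inner_smul_left]
    congr 1; push_cast; ring
  simp only [h4, ← mul_assoc, ← Finset.sum_mul] at h1
  have h5 : p.eval X = ∑ j : Fin N, g j * X ^ (j : ℕ) := by
    rw [hp, Polynomial.eval_finsetSum]; simp
  rw [← h5] at h1
  rcases mul_eq_zero.1 h1 with h | h
  · exfalso
    refine h2 X ?_ rfl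
    rw [Multiset.mem_toFinset, Polynomial.mem_roots hp0]
    exact h
  · exact h


set_option maxHeartbeats 2000000 in
lemma slice_zero (n : ℕ) (hn : 1 ≤ n) (lam : ℝ) (hl : lam ≠ 0) {G : EE n × EE n → ℂ}
    (hG : Integrable G) {u v : LL n} (hW : IsW n lam G u v) {B : Set (EE n × EE n)}
    (hBm : MeasurableSet B) (hBfin : volume B < ⊤) (hB : ∀ᵐ z, z ∉ B → G z = 0) :
    ∀ᵐ z, G z = 0 := by
  set c : ℝ := |(-lam / (2 * Real.pi)) ^ n| with hc
  have hc0 : 0 ≤ c := abs_nonneg _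
  suffices huv : ‖u‖ * ‖v‖ = 0 by
    filter_upwards [sup_bound n lam hl hG hW] with z hz
    rw [huv, mul_zero] at hz
    exact norm_le_zero_iff.1 hz
  by_contra huv
  have hu : u ≠ 0 := by rintro rfl; simp at huv
  have hv : v ≠ 0 := by rintro rfl; simp at huv
  set M : ℝ := (volume B + 2).toReal with hM
  have hM0 : 0 ≤ M := ENNReal.toReal_nonneg
  obtain ⟨N, hN⟩ := exists_nat_gt ((c * M) ^ 2)
  set a : EE n := EuclideanSpace.single ⟨0, hn⟩ (1 : ℝ) with ha
  have ha0 : a ≠ 0 := by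
    intro h
    have := congrArg norm h
    simp [ha] at this
  obtain ⟨s, hs, hmeas⟩ := translate_meas (volume : Measure (EE n × EE n)) hBm hBfin N (a, 0)
  set B' : Set (EE n × EE n) :=
    ⋃ j ∈ Finset.range N, (fun z => z + ((j : ℝ) * s) • (a, (0 : EE n))) ⁻¹' B with hB'
  have hB'm : MeasurableSet B' := by
    refine Finset.measurableSet_biUnion _ fun j _ => ?_
    exact (measurable_id.add_const _) hBm
  have hBtop : volume B + 2 ≠ ⊤ := ENNReal.add_ne_top.2 ⟨hBfin.ne, by norm_num⟩
  have hB'top : volume B' ≠ ⊤ := (hmeas.trans_lt hBtop.lt_top).ne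
  have hB'M : volume.real B' ≤ M := ENNReal.toReal_mono hBtop hmeas
  choose w hw using fun j : Fin N => exists_mod n lam ((((j : ℕ) : ℝ) * s) • a) u
  have hli := lin_indep n lam hl a ha0 s hs u hu N w hw
  set S := Submodule.span ℂ (Set.range w) with hS
  have hfr : Module.finrank ℂ S = N := by
    rw [hS, finrank_span_eq_card hli, Fintype.card_fin]
  have hP : ∀ φ ∈ S, ∃ G' : EE n × EE n → ℂ, Integrable G' ∧ IsW n lam G' φ v ∧
      ∀ᵐ z, z ∉ B' → G' z = 0 := by
    intro φ hφ
    induction hφ using Submodule.span_induction with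
    | mem x hx =>
      obtain ⟨j, rfl⟩ := hx
      obtain ⟨G', h1, h2, h3⟩ := shift_lemma n lam hG hW hB _ (hw j)
      refine ⟨G', h1, h2, ?_⟩
      filter_upwards [h3] with z hz hzB
      apply hz
      intro hmem
      apply hzB
      rw [hB']
      simp only [Set.mem_iUnion, Finset.mem_range, Set.mem_preimage, exists_prop]
      refine ⟨j, j.2, ?_⟩
      simpa using hmem
    | zero =>
      refine ⟨0, integrable_zero _ _ _, ?_, by simp⟩
      intro φ ψ; simp
    | add x y _ _ hx hy =>
      obtain ⟨G1, a1, a2, a3⟩ := hx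
      obtain ⟨G2, b1, b2, b3⟩ := hy
      refine ⟨fun z => G1 z + G2 z, a1.add b1, ?_, ?_⟩
      · intro φ ψ
        simp only [add_mul, inner_add_left]
        rw [integral_add (fw_integrable n lam φ ψ a1) (fw_integrable n lam φ ψ b1), a2, b2]
      · filter_upwards [a3, b3] with z h1 h2 h
        rw [h1 h, h2 h, add_zero]
    | smul k x _ hx =>
      obtain ⟨G1, a1, a2, a3⟩ := hx
      refine ⟨fun z => (starRingEnd ℂ) k * G1 z, a1.const_mul _, ?_, ?_⟩
      · intro φ ψ
        simp only [mul_assoc, inner_smul_left]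
        rw [integral_const_mul, a2]
      · filter_upwards [a3] with z h1 h
        rw [h1 h, mul_zero]
  haveI : FiniteDimensional ℂ S := FiniteDimensional.span_of_finite ℂ (Set.finite_range w)
  set e := stdOrthonormalBasis ℂ S with he
  set ψ : Fin (Module.finrank ℂ S) → LL n := fun i => (e i : LL n) with hψ
  have hon : Orthonormal ℂ ψ := e.orthonormal.comp_linearIsometry S.subtypeₗᵢ
  choose G' h1 h2 h3 using fun i => hP (ψ i) (e i).2
  have hψn : ∀ i, ‖ψ i‖ = 1 := fun i => hon.1 i
  have hsup : ∀ᵐ z, ∀ i, ‖G' i z‖ ≤ c * ‖v‖ := by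
    rw [ae_all_iff]; intro i
    filter_upwards [sup_bound n lam hl (h1 i) (h2 i)] with z hz
    rwa [hψn, one_mul] at hz
  have hint : ∫ z, ∑ i, G' i z * fourierWigner n lam (ψ i) v z = ((N * ‖v‖ ^ 2 : ℝ) : ℂ) := by
    rw [integral_finsetSum _ (fun i _ => fw_integrable n lam (ψ i) v (h1 i))]
    have : ∀ i, ∫ z, G' i z * fourierWigner n lam (ψ i) v z = ((‖v‖ ^ 2 : ℝ) : ℂ) := by
      intro i
      rw [h2 i, inner_self_eq_norm_sq_to_K, inner_self_eq_norm_sq_to_K, hψn]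
      simp
    simp only [this, Finset.sum_const, Finset.card_univ, Fintype.card_fin, hfr]
    simp
  have hpt : ∀ᵐ z, ‖∑ i, G' i z * fourierWigner n lam (ψ i) v z‖ ≤
      B'.indicator (fun _ => Real.sqrt N * c * ‖v‖ ^ 2) z := by
    filter_upwards [hsup, ae_all_iff.2 h3] with z hz hz3
    by_cases hzB : z ∈ B'
    · rw [Set.indicator_of_mem hzB]
      obtain ⟨wz, hwz, hrep⟩ := fw_repr n lam v z
      have hbes : ∑ i, ‖fourierWigner n lam (ψ i) v z‖ ^ 2 ≤ ‖v‖ ^ 2 := by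
        rw [← hwz]
        have := hon.sum_inner_products_le wz (s := Finset.univ)
        refine le_trans (le_of_eq ?_) this
        refine Finset.sum_congr rfl fun i _ => ?_
        rw [hrep, norm_inner_symm]
      have hcs : ∑ i, ‖fourierWigner n lam (ψ i) v z‖ ≤ Real.sqrt N * ‖v‖ := by
        have := sq_sum_le_card_mul_sum_sq (s := Finset.univ) (f := fun i => ‖fourierWigner n lam (ψ i) v z‖)
        rw [Finset.card_univ, Fintype.card_fin, show ((Module.finrank ℂ S : ℕ) : ℝ) = (N : ℝ) by rw [hfr]] at this
        refine abs_le_of_sq_le_sq' ?_ (by positivity) |>.2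
        rw [mul_pow, Real.sq_sqrt (by positivity)]
        refine this.trans ?_
        gcongr
      calc ‖∑ i, G' i z * fourierWigner n lam (ψ i) v z‖
          ≤ ∑ i, ‖G' i z * fourierWigner n lam (ψ i) v z‖ := norm_sum_le _ _
        _ ≤ ∑ i, c * ‖v‖ * ‖fourierWigner n lam (ψ i) v z‖ := by
            refine Finset.sum_le_sum fun i _ => ?_
            rw [norm_mul]; gcongr; exact hz i
        _ = c * ‖v‖ * ∑ i, ‖fourierWigner n lam (ψ i) v z‖ := by rw [Finset.mul_sum]
        _ ≤ c * ‖v‖ * (Real.sqrt N * ‖v‖) := by gcongr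
        _ = _ := by ring
    · rw [Set.indicator_of_notMem hzB]
      simp [hz3 _ hzB]
  have hgi : Integrable (B'.indicator (fun _ => Real.sqrt N * c * ‖v‖ ^ 2)) :=
    (integrable_indicator_iff hB'm).2 (integrableOn_const hB'top)
  have hfin := norm_integral_le_of_norm_le hgi hpt
  rw [hint, integral_indicator hB'm, setIntegral_const, smul_eq_mul, Complex.norm_real,
    Real.norm_of_nonneg (by positivity)] at hfin
  have hv2 : 0 < ‖v‖ ^ 2 := by have := norm_pos_iff.2 hv; positivity
  have hNpos : 0 < (N : ℝ) := lt_of_le_of_lt (sq_nonneg _) hN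
  have hsq : 0 < Real.sqrt N := Real.sqrt_pos.2 hNpos
  have hA : (N : ℝ) * ‖v‖ ^ 2 ≤ M * (Real.sqrt N * c * ‖v‖ ^ 2) := hfin.trans (by gcongr)
  have hA2 : (N : ℝ) ≤ M * (Real.sqrt N * c) := by
    refine le_of_mul_le_mul_right ?_ hv2
    linarith
  have hA3 : Real.sqrt N ≤ c * M := by
    refine le_of_mul_le_mul_right ?_ hsq
    rw [Real.mul_self_sqrt hNpos.le]
    linarith
  have hA4 : (N : ℝ) ≤ (c * M) ^ 2 := by
    rw [← Real.sq_sqrt hNpos.le]; gcongr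
  linarith



open scoped FourierTransform in
lemma fourier_rat_zero {k : ℝ → ℂ} (hk : Integrable k)
    (h0 : ∀ q : ℚ, q ≠ 0 → ∫ t, k t * Complex.exp (Complex.I * Complex.ofReal ((-2 * Real.pi * (q : ℝ)) * t)) = 0) :
    ∀ᵐ t, k t = 0 := by
  have hcont : Continuous (𝓕 k) :=
    VectorFourier.fourierIntegral_continuous Real.continuous_fourierChar (L := innerₗ ℝ)
      continuous_inner hk
  have hq : ∀ q : ℚ, q ≠ 0 → 𝓕 k (q : ℝ) = 0 := by
    intro q hq
    rw [Real.fourier_eq', ← h0 q hq]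
    congr 1
    ext t
    rw [smul_eq_mul, mul_comm]
    congr 2
    rw [mul_comm Complex.I]
    congr 2
    simp
    ring
  have hdense : Dense (Set.range ((↑) : ℚ → ℝ) \ {0}) :=
    Dense.diff_singleton Rat.denseRange_cast 0
  have hz : 𝓕 k = 0 := by
    refine Continuous.ext_on hdense hcont continuous_const ?_
    rintro x ⟨⟨q, rfl⟩, hx⟩
    refine hq q ?_
    rintro rfl
    simp at hx
  have hs := fourier_sup hk (by rw [hz]; exact integrable_zero _ _ _)
  filter_upwards [hs] with t ht
  rw [hz] at ht
  simpa using ht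

theorem main_aux (n : ℕ) (hn : 1 ≤ n)
    (F : (EE n × EE n) × ℝ → ℂ) (hF : Integrable F)
    (B : Set (EE n × EE n)) (hBmeas : MeasurableSet B) (hBfin : volume B < ⊤)
    (hsupp : ∀ᵐ p : (EE n × EE n) × ℝ, p.1 ∉ B → F p = 0)
    (hrank : ∀ lam : ℝ, lam ≠ 0 → ∃ u v : LL n, ∀ φ ψ : LL n,
      inner ℂ u φ * inner ℂ ψ v = ∫ p : (EE n × EE n) × ℝ,
        F p * Complex.exp (Complex.I * Complex.ofReal (lam * p.2)) *
          fourierWigner n lam φ ψ p.1) :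
    ∀ᵐ p, F p = 0 := by
  rw [Measure.volume_eq_prod] at hF hsupp ⊢
  have hFe : ∀ lam : ℝ, Integrable (fun p : (EE n × EE n) × ℝ =>
      F p * Complex.exp (Complex.I * Complex.ofReal (lam * p.2))) (volume.prod volume) := by
    intro lam
    refine hF.mul_bdd (c := 1) ?_ ?_
    · apply Continuous.aestronglyMeasurable
      fun_prop
    · exact Filter.Eventually.of_forall fun p => (norm_exp_I_ofReal _).le
  have hslice : ∀ lam : ℝ, lam ≠ 0 → ∀ᵐ z : EE n × EE n,
      ∫ t, F (z, t) * Complex.exp (Complex.I * Complex.ofReal (lam * t)) = 0 := by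
    intro lam hl
    obtain ⟨u, v, huv⟩ := hrank lam hl
    refine slice_zero n hn lam hl (u := u) (v := v) (B := B)
      (hFe lam).integral_prod_left ?_ hBmeas hBfin ?_
    · intro φ ψ
      have hi : Integrable (fun p : (EE n × EE n) × ℝ =>
          F p * Complex.exp (Complex.I * Complex.ofReal (lam * p.2)) *
          fourierWigner n lam φ ψ p.1) (volume.prod volume) := by
        refine (hFe lam).mul_bdd (c := ‖φ‖ * ‖ψ‖) ?_ ?_
        · exact ((fw_meas n lam φ ψ).comp_measurable measurable_fst).aestronglyMeasurable
        · exact Filter.Eventually.of_forall fun z => fw_norm_le n lam φ ψ _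
      rw [huv φ ψ]
      refine Eq.trans ?_ (integral_prod _ hi).symm
      refine integral_congr_ae (Filter.Eventually.of_forall fun z => ?_)
      simp only
      rw [integral_mul_const]
    · filter_upwards [Measure.ae_ae_of_ae_prod hsupp] with z hz hzB
      refine integral_eq_zero_of_ae ?_
      filter_upwards [hz] with t ht
      simp [ht hzB]
  have hall : ∀ᵐ z : EE n × EE n, ∀ q : ℚ, q ≠ 0 →
      ∫ t, F (z, t) * Complex.exp (Complex.I * Complex.ofReal ((-2 * Real.pi * (q : ℝ)) * t)) = 0 := by
    rw [ae_all_iff]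
    intro q
    by_cases hq : q = 0
    · exact Filter.Eventually.of_forall fun z h => absurd hq h
    · have : (-2 * Real.pi * (q : ℝ)) ≠ 0 := by
        have := Real.pi_ne_zero
        simp [hq, this]
      filter_upwards [hslice _ this] with z hz _
      exact hz
  have hz : ∀ᵐ z : EE n × EE n, ∀ᵐ t : ℝ, F (z, t) = 0 := by
    filter_upwards [hall, hF.prod_right_ae] with z h1 h2
    exact fourier_rat_zero h2 h1
  have hint : ∫ p, ‖F p‖ ∂((volume : Measure (EE n × EE n)).prod (volume : Measure ℝ)) = 0 := by
    rw [integral_prod _ hF.norm]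
    refine integral_eq_zero_of_ae ?_
    filter_upwards [hz] with z hz
    refine integral_eq_zero_of_ae ?_
    filter_upwards [hz] with t ht
    simp [ht]
  rw [integral_eq_zero_iff_of_nonneg (fun p => norm_nonneg _) hF.norm] at hint
  filter_upwards [hint] with p hp
  simpa using hp

/-- Benedick's theorem for the Heisenberg group, rank-one version:
if `f ∈ L¹(ℍⁿ)` is supported in `B × ℝ` with `B` of finite Lebesgue measure, and the
group Fourier transform `f̂(λ)` is an operator of rank at most one for every `λ ≠ 0`,
then `f = 0` a.e. -/
theorem benedicks_heisenberg_rankOne (n : ℕ) (hn : 1 ≤ n)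
    (f : EuclideanSpace ℝ (Fin n) × EuclideanSpace ℝ (Fin n) × ℝ → ℂ)
    (hf : Integrable f)
    (B : Set (EuclideanSpace ℝ (Fin n) × EuclideanSpace ℝ (Fin n)))
    (hBmeas : MeasurableSet B) (hBfin : volume B < ⊤)
    (hsupp : ∀ᵐ p : EuclideanSpace ℝ (Fin n) × EuclideanSpace ℝ (Fin n) × ℝ,
      (p.1, p.2.1) ∉ B → f p = 0)
    (hrank : ∀ lam : ℝ, lam ≠ 0 →
      ∃ u v : Lp ℂ 2 (volume : Measure (EuclideanSpace ℝ (Fin n))),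
        ∀ φ ψ : Lp ℂ 2 (volume : Measure (EuclideanSpace ℝ (Fin n))),
          (∫ ζ : EuclideanSpace ℝ (Fin n),
              (φ : EuclideanSpace ℝ (Fin n) → ℂ) ζ *
                (starRingEnd ℂ) ((u : EuclideanSpace ℝ (Fin n) → ℂ) ζ)) *
          (∫ ζ : EuclideanSpace ℝ (Fin n),
              (v : EuclideanSpace ℝ (Fin n) → ℂ) ζ *
                (starRingEnd ℂ) ((ψ : EuclideanSpace ℝ (Fin n) → ℂ) ζ)) =
            ∫ p : EuclideanSpace ℝ (Fin n) × EuclideanSpace ℝ (Fin n) × ℝ,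
              f p * Complex.exp (Complex.I * Complex.ofReal (lam * p.2.2)) *
                fourierWigner n lam (φ : EuclideanSpace ℝ (Fin n) → ℂ)
                  (ψ : EuclideanSpace ℝ (Fin n) → ℂ) (p.1, p.2.1)) :
    f =ᵐ[volume] 0 := by
  have hmp : MeasurePreserving (MeasurableEquiv.prodAssoc :
      (EE n × EE n) × ℝ ≃ᵐ EE n × EE n × ℝ) volume volume := by
    have := measurePreserving_prodAssoc (volume : Measure (EE n)) (volume : Measure (EE n))
      (volume : Measure ℝ)
    exact this
  have key := main_aux n hn (fun p => f (MeasurableEquiv.prodAssoc p))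
    (hmp.integrable_comp_of_integrable hf) B hBmeas hBfin
    (hmp.quasiMeasurePreserving.ae hsupp) (by
      intro lam hl
      obtain ⟨u, v, h⟩ := hrank lam hl
      refine ⟨u, v, fun φ ψ => ?_⟩
      rw [inner_eq_int, inner_eq_int, h φ ψ, ← hmp.integral_comp']
      rfl)
  have hs := hmp.symm.quasiMeasurePreserving.ae key
  filter_upwards [hs] with p hp
  simpa using hp
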